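/- (Main Theorem) Let A(x) = (a_{ij}(x)) be a symmetric n×n matrix with C^∞ entries, positive semidefinite at every point and with Σᵢ a_{ii}(x) > 0 for every x ∈ ℝⁿ, and let L u = Σ_{i,j} ∂_i(a_{ij} ∂_j u). Let Γ be smooth on {x ≠ y} and satisfy hypotheses (i)–(iv); fix α > −1 and define Ω_r(x), K(x,y), M_r, N_r, Q_r as below; assume Q_r(x) > 0 for all x, r > 0. Assume: (a) for every u ∈ C²(ℝⁿ, ℝ), every x ∈ ℝⁿ and every r > 0, u(x) = M_r(u)(x) − N_r(Lu)(x); (b) for every g ∈ C_c^∞(ℝⁿ, ℝ), the potential u_g(x) := ∫_{ℝⁿ} Γ(x,y) g(y) dy is C^∞ and satisfies L u_g = −g pointwise; (c) sup_{x∈G} ∫_K Γ(x,y) dy < ∞ for all compact sets G, K ⊆ ℝⁿ. Then for every compactly supported continuous f : ℝⁿ → ℝ, the potential u_f(x) := ∫_{ℝⁿ} Γ(x,y) f(y) dy satisfies: for every x ∈ ℝⁿ, the limit as r → 0⁺ of (M_r(u_f)(x) − u_f(x))/Q_r(x) exists and equals −f(x); that is, u_f is an asymptotic average solution of L_a u =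 −f on ℝⁿ. -/

import Mathlib

open MeasureTheory Filter Topology Metric

/-- The `L`-ball `Ω_r(x) := {y ≠ x : Γ(x,y) > 1/r} ∪ {x}`. -/
def LBall {n : ℕ} (Γ : EuclideanSpace ℝ (Fin n) → EuclideanSpace ℝ (Fin n) → ℝ)
    (x : EuclideanSpace ℝ (Fin n)) (r : ℝ) : Set (EuclideanSpace ℝ (Fin n)) :=
  {y | y ≠ x ∧ 1 / r < Γ x y} ∪ {x}

/-- The partial derivative `∂_i g` in the `i`-th coordinate direction. -/
noncomputable def pd {n : ℕ} (i : Fin n) (g : EuclideanSpace ℝ (Fin n) → ℝ)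
    (x : EuclideanSpace ℝ (Fin n)) : ℝ :=
  fderiv ℝ g x (EuclideanSpace.single i 1)

/-- The divergence-form operator `L u = Σ_{i,j} ∂_i (a_{ij} ∂_j u)`. -/
noncomputable def Lop {n : ℕ} (A : EuclideanSpace ℝ (Fin n) → Matrix (Fin n) (Fin n) ℝ)
    (u : EuclideanSpace ℝ (Fin n) → ℝ) (x : EuclideanSpace ℝ (Fin n)) : ℝ :=
  ∑ i : Fin n, ∑ j : Fin n, pd i (fun z => A z i j * pd j u z) x

/-- The kernel `K(x,y) = ⟨A(y)∇_yΓ(x,y), ∇_yΓ(x,y)⟩ / Γ(x,y)^{α+2}`. -/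
noncomputable def Kker {n : ℕ} (Γ : EuclideanSpace ℝ (Fin n) → EuclideanSpace ℝ (Fin n) → ℝ)
    (A : EuclideanSpace ℝ (Fin n) → Matrix (Fin n) (Fin n) ℝ) (α : ℝ)
    (x y : EuclideanSpace ℝ (Fin n)) : ℝ :=
  (∑ i : Fin n, ∑ j : Fin n, A y i j * pd i (fun z => Γ x z) y * pd j (fun z => Γ x z) y)
    / Γ x y ^ (α + 2)

/-- `M_r(u)(x) := ((α+1)/r^{α+1}) ∫_{Ω_r(x)} u(y) K(x,y) dy`. -/
noncomputable def Mr {n : ℕ} (Γ : EuclideanSpace ℝ (Fin n) → EuclideanSpace ℝ (Fin n) → ℝ)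
    (A : EuclideanSpace ℝ (Fin n) → Matrix (Fin n) (Fin n) ℝ) (α : ℝ)
    (u : EuclideanSpace ℝ (Fin n) → ℝ) (x : EuclideanSpace ℝ (Fin n)) (r : ℝ) : ℝ :=
  ((α + 1) / r ^ (α + 1)) * ∫ y in LBall Γ x r, u y * Kker Γ A α x y

/-- `N_r(w)(x) := ((α+1)/r^{α+1}) ∫₀^r ρ^α (∫_{Ω_ρ(x)} (Γ(x,y) − 1/ρ) w(y) dy) dρ`. -/
noncomputable def Nr {n : ℕ} (Γ : EuclideanSpace ℝ (Fin n) → EuclideanSpace ℝ (Fin n) → ℝ)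
    (α : ℝ) (w : EuclideanSpace ℝ (Fin n) → ℝ) (x : EuclideanSpace ℝ (Fin n)) (r : ℝ) : ℝ :=
  ((α + 1) / r ^ (α + 1)) *
    ∫ ρ in (0 : ℝ)..r, ρ ^ α * ∫ y in LBall Γ x ρ, (Γ x y - 1 / ρ) * w y

/-- `Q_r(x) := N_r(1)(x)`. -/
noncomputable def Qr {n : ℕ} (Γ : EuclideanSpace ℝ (Fin n) → EuclideanSpace ℝ (Fin n) → ℝ)
    (α : ℝ) (x : EuclideanSpace ℝ (Fin n)) (r : ℝ) : ℝ :=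
  Nr Γ α (fun _ => 1) x r

/-- The potential `u_g(x) := ∫_{ℝⁿ} Γ(x,y) g(y) dy`. -/
noncomputable def potential {n : ℕ}
    (Γ : EuclideanSpace ℝ (Fin n) → EuclideanSpace ℝ (Fin n) → ℝ)
    (g : EuclideanSpace ℝ (Fin n) → ℝ) (x : EuclideanSpace ℝ (Fin n)) : ℝ :=
  ∫ y, Γ x y * g y

open scoped ContDiff

/-- A compactly supported continuous function is a uniform limit of smooth functions whose supports
lie in a fixed compact neighbourhood of its support. -/
theorem exists_contDiff_abs_sub_le_of_hasCompactSupport {E : Type*} [NormedAddCommGroup E]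
    [NormedSpace ℝ E] [FiniteDimensional ℝ E] {f : E → ℝ} (hf : Continuous f)
    (hfs : HasCompactSupport f) {ε : ℝ} (hε : 0 < ε) :
    ∃ g : E → ℝ, ContDiff ℝ ∞ g ∧ (∀ a, |g a - f a| ≤ ε) ∧
      ∀ a ∉ cthickening 1 (tsupport f), g a = 0 := by
  rcases Metric.uniformContinuous_iff.mp (hfs.uniformContinuous_of_continuous hf) ε hε
    with ⟨δ, hδ, hfδ⟩
  rcases hf.exists_contDiff_dist_le_of_forall_mem_ball_dist_le (lt_min one_pos hδ)
    with ⟨g, hgc, hg⟩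
  refine ⟨g, hgc, fun a => ?_, fun a ha => ?_⟩
  · rw [← Real.dist_eq]
    exact hg a ε fun y hy => (hfδ ((mem_ball.mp hy).trans_le (min_le_right _ _))).le
  · have hzero : ∀ y ∈ ball a (min 1 δ), f y = 0 := fun y hy => by
      by_contra hne
      refine ha (mem_cthickening_of_dist_le a y 1 _ (subset_tsupport f hne) ?_)
      rw [dist_comm]
      exact ((mem_ball.mp hy).trans_le (min_le_left _ _)).le
    have hfa : f a = 0 := hzero a (mem_ball_self (lt_min one_pos hδ))
    have := hg a 0 fun y hy => by simp [hzero y hy, hfa]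
    rw [hfa] at this
    exact dist_le_zero.mp this

section

variable {n : ℕ} {Γ : EuclideanSpace ℝ (Fin n) → EuclideanSpace ℝ (Fin n) → ℝ}
  {x : EuclideanSpace ℝ (Fin n)} {α r : ℝ}

theorem continuousOn_of_contDiffOn_offDiag {m : WithTop ℕ∞}
    (hΓ : ContDiffOn ℝ m
      (fun p : EuclideanSpace ℝ (Fin n) × EuclideanSpace ℝ (Fin n) => Γ p.1 p.2)
      {p | p.1 ≠ p.2}) (x : EuclideanSpace ℝ (Fin n)) :
    ContinuousOn (Γ x) {x}ᶜ :=
  hΓ.continuousOn.comp (f := fun y => (x, y)) (by fun_prop) fun _ hy => Ne.symm hy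

theorem tendsto_cocompact_zero_of_iSup (hsymm : ∀ x y, x ≠ y → Γ x y = Γ y x)
    (hdecay : ∀ K : Set (EuclideanSpace ℝ (Fin n)), IsCompact K →
      Tendsto (fun x => ⨆ y : K, Γ x (y : EuclideanSpace ℝ (Fin n))) (cocompact _) (𝓝 0))
    (x : EuclideanSpace ℝ (Fin n)) : Tendsto (Γ x) (cocompact _) (𝓝 0) := by
  refine (hdecay {x} isCompact_singleton).congr' ?_
  filter_upwards [isCompact_singleton.compl_mem_cocompact (s := {x})] with y hy
  rw [ciSup_unique]
  exact hsymm y x hy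

theorem isBounded_LBall (hlim : Tendsto (Γ x) (cocompact _) (𝓝 0)) (hr : 0 < r) :
    Bornology.IsBounded (LBall Γ x r) := by
  refine Bornology.IsBounded.union ?_ Bornology.isBounded_singleton
  have h := hlim.eventually (gt_mem_nhds (one_div_pos.mpr hr))
  rw [← cobounded_eq_cocompact] at h
  refine Bornology.isBounded_def.mpr ?_
  filter_upwards [h] with y hy hy'
  exact hy.not_gt hy'.2

theorem eventually_LBall_subset_ball (hcont : ContinuousOn (Γ x) {x}ᶜ)
    (hlim : Tendsto (Γ x) (cocompact _) (𝓝 0)) {δ : ℝ} (hδ : 0 < δ) :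
    ∀ᶠ r in 𝓝[>] (0 : ℝ), LBall Γ x r ⊆ ball x δ := by
  have hb := isBounded_LBall hlim one_pos
  obtain ⟨R, hR⟩ := hb.subset_closedBall x
  have hK : IsCompact (closedBall x R \ ball x δ) := (isCompact_closedBall x R).diff isOpen_ball
  obtain ⟨C, hC⟩ := hK.bddAbove_image
    (hcont.mono fun y hy (hyx : y = x) => hy.2 (hyx ▸ mem_ball_self hδ))
  have hinv : Tendsto (fun r : ℝ => 1 / r) (𝓝[>] 0) atTop := by
    simpa using tendsto_inv_nhdsGT_zero (𝕜 := ℝ)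
  filter_upwards [hinv.eventually_ge_atTop (max C 1)] with r hr y hy
  rcases hy with ⟨hyx, hy⟩ | rfl
  · by_contra hyb
    have h1 : y ∈ LBall Γ x 1 := Or.inl ⟨hyx, by linarith [le_max_right C 1]⟩
    have h2 := hC ⟨y, ⟨hR h1, hyb⟩, rfl⟩
    linarith [le_max_left C 1]
  · exact mem_ball_self hδ

theorem LBall_subset_LBall {ρ : ℝ} (hρ : 0 < ρ) (hρr : ρ ≤ r) : LBall Γ x ρ ⊆ LBall Γ x r :=
  Set.union_subset_union_left _ fun _ hy =>
    ⟨hy.1, (one_div_le_one_div_of_le hρ hρr).trans_lt hy.2⟩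

theorem measurableSet_LBall (hΓ : Measurable (Γ x)) (r : ℝ) : MeasurableSet (LBall Γ x r) :=
  ((measurableSet_singleton x).compl.inter (measurableSet_lt measurable_const hΓ)).union
    (measurableSet_singleton x)

theorem integrableOn_LBall_mul (hloc : LocallyIntegrable (Γ x) volume)
    (hlim : Tendsto (Γ x) (cocompact _) (𝓝 0)) (hr : 0 < r)
    {w : EuclideanSpace ℝ (Fin n) → ℝ} (hw : Continuous w) :
    IntegrableOn (fun y => (Γ x y - 1 / r) * w y) (LBall Γ x r) := by
  obtain ⟨R, hR⟩ := (isBounded_LBall hlim hr).subset_closedBall x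
  have hK := isCompact_closedBall x R
  refine IntegrableOn.mono_set (IntegrableOn.mul_continuousOn ?_ hw.continuousOn hK) hR
  exact (hloc.integrableOn_isCompact hK).sub (continuousOn_const.integrableOn_compact hK)

theorem measurable_setIntegral_LBall (hΓ : Measurable (Γ x))
    {w : EuclideanSpace ℝ (Fin n) → ℝ} (hw : Measurable w) :
    Measurable fun ρ : ℝ => ∫ y in LBall Γ x ρ, (Γ x y - 1 / ρ) * w y := by
  have hS : MeasurableSet {p : ℝ × EuclideanSpace ℝ (Fin n) | p.2 ∈ LBall Γ x p.1} :=
    ((measurable_snd (measurableSet_singleton x).compl).inter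
      (measurableSet_lt (by fun_prop) (hΓ.comp measurable_snd))).union
      (measurable_snd (measurableSet_singleton x))
  have hm : Measurable ({p : ℝ × EuclideanSpace ℝ (Fin n) | p.2 ∈ LBall Γ x p.1}.indicator
      fun p => (Γ x p.2 - 1 / p.1) * w p.2) :=
    Measurable.indicator (by fun_prop) hS
  have h := hm.stronglyMeasurable.integral_prod_right' (ν := volume)
  convert h.measurable using 2 with ρ
  exact (integral_indicator (measurableSet_LBall hΓ ρ)).symm

/-- On a fixed `L`-ball, the weight defining `N_r` is nonnegative, so integrals against it are
controlled by `sup |w|` times the integral of the weight. -/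
theorem abs_setIntegral_LBall_le [NeZero n] (hΓ : Measurable (Γ x))
    (hloc : LocallyIntegrable (Γ x) volume)
    (hlim : Tendsto (Γ x) (cocompact _) (𝓝 0)) (hr : 0 < r)
    {w : EuclideanSpace ℝ (Fin n) → ℝ} {C : ℝ} (hC : ∀ y ∈ LBall Γ x r, |w y| ≤ C) :
    |∫ y in LBall Γ x r, (Γ x y - 1 / r) * w y| ≤
      C * ∫ y in LBall Γ x r, (Γ x y - 1 / r) * 1 := by
  rw [← integral_const_mul, ← Real.norm_eq_abs]
  refine norm_integral_le_of_norm_le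
    ((integrableOn_LBall_mul hloc hlim hr continuous_const).const_mul C) ?_
  have hne : ∀ᵐ y ∂volume.restrict (LBall Γ x r), y ≠ x :=
    ae_restrict_of_ae (Measure.ae_ne volume x)
  filter_upwards [hne, ae_restrict_mem (measurableSet_LBall hΓ r)] with y hyx hy
  have hpos : 0 ≤ Γ x y - 1 / r := by
    rcases hy with hy | hy
    · exact sub_nonneg.mpr hy.2.le
    · exact absurd hy hyx
  rw [norm_mul, Real.norm_of_nonneg hpos, Real.norm_eq_abs, mul_one, mul_comm]
  exact mul_le_mul_of_nonneg_right (hC y hy) hpos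

theorem intervalIntegrable_Nr [NeZero n] (hΓ : Measurable (Γ x))
    (hloc : LocallyIntegrable (Γ x) volume)
    (hlim : Tendsto (Γ x) (cocompact _) (𝓝 0)) (hr : 0 < r) (hQ : Qr Γ α x r ≠ 0)
    {w : EuclideanSpace ℝ (Fin n) → ℝ} (hw : Continuous w) :
    IntervalIntegrable (fun ρ : ℝ => ρ ^ α * ∫ y in LBall Γ x ρ, (Γ x y - 1 / ρ) * w y)
      volume 0 r := by
  have h1 : IntervalIntegrable (fun ρ : ℝ => ρ ^ α * ∫ y in LBall Γ x ρ, (Γ x y - 1 / ρ) * 1)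
      volume 0 r :=
    intervalIntegral.intervalIntegrable_of_integral_ne_zero (right_ne_zero_of_mul hQ)
  obtain ⟨R, hR⟩ := (isBounded_LBall hlim hr).subset_closedBall x
  obtain ⟨C, hC⟩ := (isCompact_closedBall x R).exists_bound_of_continuousOn hw.continuousOn
  rw [intervalIntegrable_iff_integrableOn_Ioc_of_le hr.le] at h1 ⊢
  refine (h1.const_mul C).mono' ?_ ?_
  · have := measurable_setIntegral_LBall hΓ hw.measurable
    exact Measurable.aestronglyMeasurable (by fun_prop)
  filter_upwards [ae_restrict_mem measurableSet_Ioc] with ρ hρ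
  have hρα : 0 ≤ ρ ^ α := Real.rpow_nonneg hρ.1.le α
  rw [norm_mul, Real.norm_of_nonneg hρα, mul_left_comm]
  exact mul_le_mul_of_nonneg_left (abs_setIntegral_LBall_le hΓ hloc hlim hρ.1
    fun y hy => hC y (hR (LBall_subset_LBall hρ.1 hρ.2 hy))) hρα

theorem abs_Nr_sub_Nr_le [NeZero n] (hΓ : Measurable (Γ x))
    (hloc : LocallyIntegrable (Γ x) volume)
    (hlim : Tendsto (Γ x) (cocompact _) (𝓝 0)) (hα : -1 < α) (hr : 0 < r)
    (hQ : Qr Γ α x r ≠ 0) {v w : EuclideanSpace ℝ (Fin n) → ℝ} (hv : Continuous v)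
    (hw : Continuous w) {ε : ℝ} (hε : ∀ y ∈ LBall Γ x r, |v y - w y| ≤ ε) :
    |Nr Γ α v x r - Nr Γ α w x r| ≤ ε * Qr Γ α x r := by
  have hc : 0 ≤ (α + 1) / r ^ (α + 1) :=
    div_nonneg (by linarith) (Real.rpow_nonneg hr.le _)
  have hint := intervalIntegrable_Nr hΓ hloc hlim hr hQ (w := fun _ => 1) continuous_const
  simp only [Qr, Nr]
  rw [← mul_sub, ← intervalIntegral.integral_sub (intervalIntegrable_Nr hΓ hloc hlim hr hQ hv)
    (intervalIntegrable_Nr hΓ hloc hlim hr hQ hw), abs_mul, abs_of_nonneg hc, mul_left_comm]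
  refine mul_le_mul_of_nonneg_left ?_ hc
  rw [← intervalIntegral.integral_const_mul, ← Real.norm_eq_abs]
  refine intervalIntegral.norm_integral_le_of_norm_le hr.le (ae_of_all _ fun ρ hρ => ?_)
    (hint.const_mul ε)
  have hρα : 0 ≤ ρ ^ α := Real.rpow_nonneg hρ.1.le α
  rw [← mul_sub, ← integral_sub (integrableOn_LBall_mul hloc hlim hρ.1 hv)
    (integrableOn_LBall_mul hloc hlim hρ.1 hw), norm_mul, Real.norm_of_nonneg hρα, mul_left_comm]
  simp_rw [← mul_sub]
  exact mul_le_mul_of_nonneg_left (abs_setIntegral_LBall_le hΓ hloc hlim hρ.1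
    fun y hy => hε y (LBall_subset_LBall hρ.1 hρ.2 hy)) hρα

theorem Nr_const (c : ℝ) : Nr Γ α (fun _ => c) x r = c * Qr Γ α x r := by
  have h : ∀ ρ : ℝ, ρ ^ α * ∫ y in LBall Γ x ρ, (Γ x y - 1 / ρ) * c =
      c * (ρ ^ α * ∫ y in LBall Γ x ρ, (Γ x y - 1 / ρ) * 1) := fun ρ => by
    simp only [mul_one, integral_mul_const]
    ring
  simp only [Qr, Nr, h, intervalIntegral.integral_const_mul]
  ring

theorem Nr_neg (w : EuclideanSpace ℝ (Fin n) → ℝ) :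
    Nr Γ α (fun y => -w y) x r = -Nr Γ α w x r := by
  simp only [Nr, mul_neg, integral_neg, intervalIntegral.integral_neg]

theorem Lop_const (A : EuclideanSpace ℝ (Fin n) → Matrix (Fin n) (Fin n) ℝ) (c : ℝ) :
    Lop A (fun _ => c) = fun _ => 0 := by
  ext y
  simp [Lop, pd]

theorem integrableOn_Kker {A : EuclideanSpace ℝ (Fin n) → Matrix (Fin n) (Fin n) ℝ}
    (h : Mr Γ A α (fun _ => 1) x r ≠ 0) : IntegrableOn (Kker Γ A α x) (LBall Γ x r) := by
  have h' := right_ne_zero_of_mul h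
  simp only [one_mul] at h'
  exact Integrable.of_integral_ne_zero h'

/-- Bounded pointwise convergence of continuous functions passes to the solid averages `M_r`. -/
theorem tendsto_Mr {A : EuclideanSpace ℝ (Fin n) → Matrix (Fin n) (Fin n) ℝ}
    (hΓ : Measurable (Γ x)) (hK : IntegrableOn (Kker Γ A α x) (LBall Γ x r))
    {U : ℕ → EuclideanSpace ℝ (Fin n) → ℝ} {u : EuclideanSpace ℝ (Fin n) → ℝ}
    (hU : ∀ k, Continuous (U k)) {C : ℝ} (hC : ∀ k, ∀ y ∈ LBall Γ x r, |U k y| ≤ C)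
    (hlim : ∀ y, Tendsto (fun k => U k y) atTop (𝓝 (u y))) :
    Tendsto (fun k => Mr Γ A α (U k) x r) atTop (𝓝 (Mr Γ A α u x r)) := by
  refine Tendsto.const_mul _ (tendsto_integral_of_dominated_convergence
    (fun y => C * ‖Kker Γ A α x y‖) (fun k => ?_) (hK.norm.const_mul C) (fun k => ?_) ?_)
  · exact (hU k).aestronglyMeasurable.mul hK.aestronglyMeasurable
  · filter_upwards [ae_restrict_mem (measurableSet_LBall hΓ r)] with y hy
    rw [norm_mul]
    exact mul_le_mul_of_nonneg_right (hC k y hy) (norm_nonneg _)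
  · exact ae_of_all _ fun y => (hlim y).mul_const _

theorem abs_potential_le [NeZero n] (hpos : ∀ y, x ≠ y → 0 < Γ x y)
    (hloc : LocallyIntegrable (Γ x) volume) {K : Set (EuclideanSpace ℝ (Fin n))}
    (hK : IsCompact K) {g : EuclideanSpace ℝ (Fin n) → ℝ} {M : ℝ} (hM : ∀ y, |g y| ≤ M)
    (hg : ∀ y ∉ K, g y = 0) : |potential Γ g x| ≤ M * ∫ y in K, Γ x y := by
  have h : potential Γ g x = ∫ y in K, Γ x y * g y :=
    (setIntegral_eq_integral_of_forall_compl_eq_zero fun y hy => by simp [hg y hy]).symm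
  rw [h, ← integral_const_mul, ← Real.norm_eq_abs]
  refine norm_integral_le_of_norm_le ((hloc.integrableOn_isCompact hK).const_mul M) ?_
  filter_upwards [ae_restrict_of_ae (Measure.ae_ne volume x)] with y hy
  rw [norm_mul, Real.norm_of_nonneg (hpos y hy.symm).le, mul_comm]
  exact mul_le_mul_of_nonneg_right (hM y) (hpos y hy.symm).le

theorem tendsto_potential (hloc : LocallyIntegrable (Γ x) volume)
    {K : Set (EuclideanSpace ℝ (Fin n))} (hK : IsCompact K)
    {F : ℕ → EuclideanSpace ℝ (Fin n) → ℝ} {f : EuclideanSpace ℝ (Fin n) → ℝ} {M : ℝ}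
    (hF : ∀ k, Continuous (F k)) (hM : ∀ k y, |F k y| ≤ M) (hFK : ∀ k, ∀ y ∉ K, F k y = 0)
    (hlim : ∀ y, Tendsto (fun k => F k y) atTop (𝓝 (f y))) :
    Tendsto (fun k => potential Γ (F k) x) atTop (𝓝 (potential Γ f x)) := by
  refine tendsto_integral_of_dominated_convergence
    (K.indicator fun y => M * ‖Γ x y‖) (fun k => ?_) ?_ (fun k => ae_of_all _ fun y => ?_)
    (ae_of_all _ fun y => (hlim y).const_mul _)
  · exact hloc.aestronglyMeasurable.mul (hF k).aestronglyMeasurable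
  · exact (integrable_indicator_iff hK.measurableSet).mpr
      ((hloc.integrableOn_isCompact hK).norm.const_mul M)
  · by_cases hy : y ∈ K
    · rw [Set.indicator_of_mem hy, norm_mul, mul_comm]
      exact mul_le_mul_of_nonneg_right (hM k y) (norm_nonneg _)
    · simp [hFK k y hy, hy]

end

/-- Main Theorem: under the structural hypotheses on `A`, `Γ` and
hypotheses (a), (b), (c), for every compactly supported continuous `f`, the potential
`u_f(x) = ∫ Γ(x,y) f(y) dy` satisfies
`(M_r(u_f)(x) − u_f(x))/Q_r(x) → −f(x)` as `r → 0⁺`, at every `x ∈ ℝⁿ`;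
i.e. `u_f` is an asymptotic average solution of `L_a u = −f` on `ℝⁿ`. -/
theorem main_theorem_asymptotic_average_solution {n : ℕ}
    (A : EuclideanSpace ℝ (Fin n) → Matrix (Fin n) (Fin n) ℝ)
    (hAsymm : ∀ x, (A x).IsSymm)
    (hAsmooth : ∀ i j, ContDiff ℝ (⊤ : ℕ∞) fun x => A x i j)
    (hApsd : ∀ x, (A x).PosSemidef)
    (hAtrace : ∀ x, 0 < ∑ i : Fin n, A x i i)
    (Γ : EuclideanSpace ℝ (Fin n) → EuclideanSpace ℝ (Fin n) → ℝ)
    (hΓsmooth : ContDiffOn ℝ (⊤ : ℕ∞)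
      (fun p : EuclideanSpace ℝ (Fin n) × EuclideanSpace ℝ (Fin n) => Γ p.1 p.2)
      {p | p.1 ≠ p.2})
    (hsymm : ∀ x y, x ≠ y → Γ x y = Γ y x)
    (hpos : ∀ x y, x ≠ y → 0 < Γ x y)
    (hblow : ∀ y, Tendsto (fun x => Γ x y) (𝓝[≠] y) atTop)
    (hdecay : ∀ K : Set (EuclideanSpace ℝ (Fin n)), IsCompact K →
      Tendsto (fun x => ⨆ y : K, Γ x (y : EuclideanSpace ℝ (Fin n)))
        (Filter.cocompact _) (𝓝 0))
    (hloc : ∀ x, LocallyIntegrable (Γ x) volume)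
    (α : ℝ) (hα : -1 < α)
    (hQ : ∀ (x : EuclideanSpace ℝ (Fin n)) (r : ℝ), 0 < r → 0 < Qr Γ α x r)
    (hrep : ∀ u : EuclideanSpace ℝ (Fin n) → ℝ, ContDiff ℝ 2 u →
      ∀ (x : EuclideanSpace ℝ (Fin n)) (r : ℝ), 0 < r →
        u x = Mr Γ A α u x r - Nr Γ α (Lop A u) x r)
    (hpot : ∀ g : EuclideanSpace ℝ (Fin n) → ℝ, ContDiff ℝ (⊤ : ℕ∞) g → HasCompactSupport g →
      ContDiff ℝ (⊤ : ℕ∞) (potential Γ g) ∧ ∀ x, Lop A (potential Γ g) x = -g x)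
    (hsup : ∀ G K : Set (EuclideanSpace ℝ (Fin n)), IsCompact G → IsCompact K →
      ∃ C : ℝ, ∀ x ∈ G, (∫ y in K, Γ x y) ≤ C)
    (f : EuclideanSpace ℝ (Fin n) → ℝ) (hf : Continuous f) (hfs : HasCompactSupport f)
    (x : EuclideanSpace ℝ (Fin n)) :
    Tendsto
      (fun r : ℝ => (Mr Γ A α (potential Γ f) x r - potential Γ f x) / Qr Γ α x r)
      (𝓝[>] 0) (𝓝 (-f x)) := by
  have : NeZero n := ⟨by
    rintro rfl
    simpa using hAtrace 0⟩
  have hlim := tendsto_cocompact_zero_of_iSup hsymm hdecay x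
  have hcont := continuousOn_of_contDiffOn_offDiag hΓsmooth x
  have hΓ : Measurable (Γ x) := measurable_of_continuousOn_compl_singleton x hcont
  have hmean : ∀ r : ℝ, 0 < r → Mr Γ A α (potential Γ f) x r - potential Γ f x =
      -Nr Γ α f x r := by
    intro r hr
    set K := cthickening 1 (tsupport f)
    have hK : IsCompact K := hfs.isCompact.cthickening
    obtain ⟨B, hB⟩ := hfs.exists_bound_of_continuous hf
    obtain ⟨η, -, hη, hη0⟩ := exists_seq_strictAnti_tendsto' (one_pos (α := ℝ))
    choose F hFsmooth hFdist hFK using fun k =>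
      exists_contDiff_abs_sub_le_of_hasCompactSupport hf hfs (hη k).1
    have hFlim : ∀ y, Tendsto (fun k => F k y) atTop (𝓝 (f y)) := fun y =>
      tendsto_iff_norm_sub_tendsto_zero.mpr
        (squeeze_zero (fun _ => norm_nonneg _) (fun k => hFdist k y) hη0)
    have hFM : ∀ k y, |F k y| ≤ B + 1 := fun k y => by
      have h1 := abs_sub_abs_le_abs_sub (F k y) (f y)
      have h2 := hB y
      rw [Real.norm_eq_abs] at h2
      linarith [hFdist k y, (hη k).2]
    have hFsupp : ∀ k, HasCompactSupport (F k) := fun k => HasCompactSupport.intro hK (hFK k)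
    obtain ⟨R, hR⟩ := (isBounded_LBall hlim hr).subset_closedBall x
    obtain ⟨C, hC⟩ := hsup (closedBall x R) K (isCompact_closedBall x R) hK
    have hB1 : 0 ≤ B + 1 := (abs_nonneg _).trans (hFM 0 x)
    have hpotlim : ∀ y, Tendsto (fun k => potential Γ (F k) y) atTop (𝓝 (potential Γ f y)) :=
      fun y => tendsto_potential (hloc y) hK (fun k => (hFsmooth k).continuous) hFM hFK hFlim
    have hM1 : Mr Γ A α (fun _ => 1) x r = 1 := by
      have h := hrep (fun _ => 1) contDiff_const x r hr
      rw [Lop_const, Nr_const] at h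
      linarith
    have hMlim : Tendsto (fun k => Mr Γ A α (potential Γ (F k)) x r) atTop
        (𝓝 (Mr Γ A α (potential Γ f) x r)) :=
      tendsto_Mr hΓ (integrableOn_Kker (by rw [hM1]; exact one_ne_zero))
        (fun k => (hpot _ (hFsmooth k) (hFsupp k)).1.continuous)
        (fun k y hy => (abs_potential_le (hpos y) (hloc y) hK (hFM k) (hFK k)).trans
          (mul_le_mul_of_nonneg_left (hC y (hR hy)) hB1)) hpotlim
    have hNlim : Tendsto (fun k => Nr Γ α (F k) x r) atTop (𝓝 (Nr Γ α f x r)) := by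
      refine tendsto_iff_norm_sub_tendsto_zero.mpr
        (squeeze_zero (fun _ => norm_nonneg _) (fun k => ?_)
          (by simpa using hη0.mul_const (Qr Γ α x r)))
      exact abs_Nr_sub_Nr_le hΓ (hloc x) hlim hα hr (hQ x r hr).ne' (hFsmooth k).continuous hf
        fun y _ => hFdist k y
    refine tendsto_nhds_unique (hMlim.sub (hpotlim x)) (hNlim.neg.congr fun k => ?_)
    obtain ⟨hsm, hL⟩ := hpot _ (hFsmooth k) (hFsupp k)
    have h := hrep _ (contDiff_infty.mp hsm 2) x r hr
    rw [funext hL, Nr_neg] at h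
    linarith
  rw [Metric.tendsto_nhds]
  intro ε hε
  obtain ⟨δ, hδ, hfδ⟩ := Metric.continuous_iff.mp hf x (ε / 2) (half_pos hε)
  filter_upwards [eventually_LBall_subset_ball hcont hlim hδ, self_mem_nhdsWithin] with r hsub hr
  have hQr := hQ x r hr
  have h := abs_Nr_sub_Nr_le hΓ (hloc x) hlim hα hr hQr.ne' hf continuous_const
    fun y hy => (hfδ y (mem_ball.mp (hsub hy))).le
  rw [Nr_const] at h
  have heq : -Nr Γ α f x r / Qr Γ α x r - -f x =
      -((Nr Γ α f x r - f x * Qr Γ α x r) / Qr Γ α x r) := by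
    field_simp
    ring
  rw [hmean r hr, Real.dist_eq, heq, abs_neg, abs_div, abs_of_pos hQr]
  exact ((div_le_iff₀ hQr).mpr h).trans_lt (half_lt_self hε)
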